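/- Let 𝔑₁₂ be the 4-dimensional complex Leibniz algebra with basis e₁,e₂,e₃,e₄ and nonzero products of basis vectors e₁e₂ = e₃, e₂e₁ = e₄. Then H²(𝔑₁₂,ℂ) has dimension 6, with basis given by the classes [Δ₁₁], [Δ₂₂], [−Δ₁₃+Δ₁₄+Δ₃₁], [Δ₃₂], [Δ₄₁], [Δ₂₃−Δ₂₄+Δ₄₂]. -/

import Mathlib

noncomputable section

/-- The bilinear multiplication on `ℂⁿ` determined by structure constants `c`,
with `eᵢ eⱼ = ∑ₖ c i j k • eₖ`. -/
def mulOf {n : ℕ} (c : Fin n → Fin n → Fin n → ℂ) (x y : Fin n → ℂ) : Fin n → ℂ :=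
  fun k => ∑ i, ∑ j, x i * y j * c i j k

/-- The bilinear form on `ℂⁿ` determined by the matrix `M`, with `θ(eᵢ,eⱼ) = M i j`. -/
def formOf {n : ℕ} (M : Matrix (Fin n) (Fin n) ℂ) (x y : Fin n → ℂ) : ℂ :=
  ∑ i, ∑ j, x i * M i j * y j

/-- `M` represents a cocycle: `θ(xy,z) = θ(xz,y) + θ(x,yz)` for all `x,y,z`. -/
def IsCocycle {n : ℕ} (c : Fin n → Fin n → Fin n → ℂ) (M : Matrix (Fin n) (Fin n) ℂ) : Prop :=
  ∀ x y z : Fin n → ℂ,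
    formOf M (mulOf c x y) z = formOf M (mulOf c x z) y + formOf M x (mulOf c y z)

/-- The bilinear form `Δ_{ij}` with `Δ_{ij}(e_l,e_m) = δ_{il} δ_{jm}` (as a matrix). -/
def Δ {n : ℕ} (i j : Fin n) : Matrix (Fin n) (Fin n) ℂ :=
  fun l m => if l = i ∧ m = j then 1 else 0

/-- `H²` of the algebra with structure constants `c` has dimension `d`, and the classes of
the cocycles `M 0, …, M (d-1)` form a basis: each `M i` is a cocycle, and every cocycle `N`
is, for a unique coefficient vector `a`, the sum of `∑ i, a i • M i` and a coboundary
`(x,y) ↦ f(xy)` (where `f` is the linear functional with coefficients `g`). -/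
def HBasis {n d : ℕ} (c : Fin n → Fin n → Fin n → ℂ)
    (M : Fin d → Matrix (Fin n) (Fin n) ℂ) : Prop :=
  (∀ i, IsCocycle c (M i)) ∧
  (∀ N : Matrix (Fin n) (Fin n) ℂ, IsCocycle c N →
    ∃! a : Fin d → ℂ, ∃ g : Fin n → ℂ, ∀ x y : Fin n → ℂ,
      formOf N x y = (∑ i, a i * formOf (M i) x y) + ∑ l, mulOf c x y l * g l)

/-- Every cocycle differs by a coboundary from a cocycle additionally satisfying the
"symmetric" identity `θ(x,yz) = θ(xy,z) + θ(y,xz)`, i.e. `H² = H²_𝒮`. -/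
def SymmReduce {n : ℕ} (c : Fin n → Fin n → Fin n → ℂ) : Prop :=
  ∀ N : Matrix (Fin n) (Fin n) ℂ, IsCocycle c N →
    ∃ (N' : Matrix (Fin n) (Fin n) ℂ) (g : Fin n → ℂ),
      IsCocycle c N' ∧
      (∀ x y z : Fin n → ℂ,
        formOf N' x (mulOf c y z) = formOf N' (mulOf c x y) z + formOf N' y (mulOf c x z)) ∧
      (∀ x y : Fin n → ℂ, formOf N x y = formOf N' x y + ∑ l, mulOf c x y l * g l)


/-- The 4-dimensional Leibniz algebra `𝔑₁₂`: `e₁e₂ = e₃`, `e₂e₁ = e₄`. -/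
def cM12 : Fin 4 → Fin 4 → Fin 4 → ℂ := fun i j k =>
  (if i = 0 ∧ j = 1 ∧ k = 2 then 1 else 0) +
  (if i = 1 ∧ j = 0 ∧ k = 3 then 1 else 0)

theorem mulOf_cM12 (x y : Fin 4 → ℂ) :
    mulOf cM12 x y = ![0, 0, x 0 * y 1, x 1 * y 0] := by
  have hc : ∀ i j k, cM12 i j k = (if i = 0 ∧ j = 1 ∧ k = 2 then 1 else 0) +
    (if i = 1 ∧ j = 0 ∧ k = 3 then 1 else 0) := fun _ _ _ => rfl
  funext k
  simp only [mulOf, hc, ite_and, mul_add, mul_ite, mul_one, mul_zero, Finset.sum_add_distrib,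
    Finset.sum_ite_eq', Finset.mem_univ, if_true]
  fin_cases k <;> simp

theorem formOf_single (M : Matrix (Fin 4) (Fin 4) ℂ) (i j : Fin 4) :
    formOf M (Pi.single i 1) (Pi.single j 1) = M i j := by
  simp [formOf, Pi.single_apply]

theorem Δ_apply (i j l m : Fin 4) :
    (Δ i j : Matrix (Fin 4) (Fin 4) ℂ) l m = if l = i ∧ m = j then 1 else 0 := rfl

theorem formOf_Δ (i j : Fin 4) (x y : Fin 4 → ℂ) : formOf (Δ i j) x y = x i * y j := by
  simp [formOf, Δ_apply, ite_and]

theorem formOf_add (M N : Matrix (Fin 4) (Fin 4) ℂ) (x y : Fin 4 → ℂ) :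
    formOf (M + N) x y = formOf M x y + formOf N x y := by
  simp only [formOf, Matrix.add_apply, ← Finset.sum_add_distrib, mul_add, add_mul]

theorem formOf_neg (M : Matrix (Fin 4) (Fin 4) ℂ) (x y : Fin 4 → ℂ) :
    formOf (-M) x y = -formOf M x y := by
  simp [formOf]

theorem formOf_sub (M N : Matrix (Fin 4) (Fin 4) ℂ) (x y : Fin 4 → ℂ) :
    formOf (M - N) x y = formOf M x y - formOf N x y := by
  rw [sub_eq_add_neg, formOf_add, formOf_neg, sub_eq_add_neg]

/-- `H²(𝔑₁₂,ℂ)` has dimension 6, with basis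
`[Δ₁₁], [Δ₂₂], [-Δ₁₃+Δ₁₄+Δ₃₁], [Δ₃₂], [Δ₄₁], [Δ₂₃-Δ₂₄+Δ₄₂]`. -/
theorem statement12 :
    HBasis cM12
      ![Δ 0 0, Δ 1 1, -Δ 0 2 + Δ 0 3 + Δ 2 0, Δ 2 1, Δ 3 0, Δ 1 2 - Δ 1 3 + Δ 3 1] := by
  refine ⟨?_, ?_⟩
  · intro i x y z
    rw [mulOf_cM12, mulOf_cM12, mulOf_cM12]
    fin_cases i <;> simp [formOf_Δ, formOf_add, formOf_neg, formOf_sub] <;> ring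
  · intro N hN
    have key : ∀ x y z : Fin 4 → ℂ, formOf N ![0, 0, x 0 * y 1, x 1 * y 0] z =
        formOf N ![0, 0, x 0 * z 1, x 1 * z 0] y +
          formOf N x ![0, 0, y 0 * z 1, y 1 * z 0] := by
      intro x y z
      have h := hN x y z
      rwa [mulOf_cM12, mulOf_cM12, mulOf_cM12] at h
    have h1 := key ![1, 0, 0, 0] ![0, 1, 0, 0] ![1, 0, 0, 0]
    have h2 := key ![1, 0, 0, 0] ![1, 0, 0, 0] ![0, 1, 0, 0]
    have h3 := key ![0, 1, 0, 0] ![1, 0, 0, 0] ![0, 1, 0, 0]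
    have h4 := key ![0, 1, 0, 0] ![0, 1, 0, 0] ![1, 0, 0, 0]
    have h5 := key ![1, 0, 0, 0] ![0, 1, 0, 0] ![0, 0, 1, 0]
    have h6 := key ![1, 0, 0, 0] ![0, 1, 0, 0] ![0, 0, 0, 1]
    have h7 := key ![0, 1, 0, 0] ![1, 0, 0, 0] ![0, 0, 1, 0]
    have h8 := key ![0, 1, 0, 0] ![1, 0, 0, 0] ![0, 0, 0, 1]
    simp [formOf, Fin.sum_univ_four] at h1 h2 h3 h4 h5 h6 h7 h8
    have h2' : N 0 2 = - N 2 0 := by linear_combination -h2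
    have h4' : N 1 3 = - N 3 1 := by linear_combination -h4
    refine ⟨![N 0 0, N 1 1, N 2 0, N 2 1, N 3 0, N 3 1], ⟨![0, 0, N 0 1, N 1 0], ?_⟩, ?_⟩
    · intro x y
      rw [mulOf_cM12]
      simp [formOf_Δ, formOf_add, formOf_neg, formOf_sub, Fin.sum_univ_six, Fin.sum_univ_four]
      simp only [formOf, Fin.sum_univ_four, h2', h4', h5, h6, h7, h8, ← h1, ← h3]
      ring
    · rintro a ⟨g, hg⟩
      have e0 := hg (Pi.single 0 1) (Pi.single 0 1)
      have e1 := hg (Pi.single 1 1) (Pi.single 1 1)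
      have e2 := hg (Pi.single 2 1) (Pi.single 0 1)
      have e3 := hg (Pi.single 2 1) (Pi.single 1 1)
      have e4 := hg (Pi.single 3 1) (Pi.single 0 1)
      have e5 := hg (Pi.single 3 1) (Pi.single 1 1)
      simp only [formOf_single, mulOf_cM12] at e0 e1 e2 e3 e4 e5
      simp [Δ_apply, formOf_Δ, formOf_add, formOf_neg, formOf_sub, Fin.sum_univ_six,
        Fin.sum_univ_four] at e0 e1 e2 e3 e4 e5
      funext k
      fin_cases k <;> simp [e0, e1, e2, e3, e4, e5]
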